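/- Let R be a Cohen–Macaulay commutative noetherian local ring and let M and N be nonzero finitely generated R-modules. Suppose there is a short exact sequence 0 → M → P → X → 0 of finitely generated R-modules in which P has finite projective dimension and X is totally reflexive, and set n = depth R − depth_R(M) (the Gorenstein dimension of M) and m = max{depth_R(M), depth_R(N)}; assume n > 0. Fix a finite free presentation of X and let T be its transpose. If Tor_i^R(M,N) = 0 for all 1 ≤ i ≤ n, Tor_j^R(X,N) = 0 for all 1 ≤ j ≤ n+1, and Ext^j_R(T,N) = 0 for all 1 ≤ j ≤ m, then depth_R(M ⊗_R N) + depth R = depth_R(M) + depth_R(N). -/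

import Mathlib

open CategoryTheory

universe u

/-- The `i`-th Ext module `Ext_R^i(M, N)` of `R`-modules `M` and `N`. -/
noncomputable def extModule (R : Type u) [CommRing R] (M N : Type u)
    [AddCommGroup M] [Module R M] [AddCommGroup N] [Module R N] (i : ℕ) : ModuleCat.{u} R :=
  ((Ext R (ModuleCat.{u} R) i).obj (Opposite.op (ModuleCat.of R M))).obj (ModuleCat.of R N)

/-- The `i`-th Tor module `Tor^R_i(M, N)` of `R`-modules `M` and `N`. -/
noncomputable def torModule (R : Type u) [CommRing R] (M N : Type u)
    [AddCommGroup M] [Module R M] [AddCommGroup N] [Module R N] (i : ℕ) : ModuleCat.{u} R :=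
  ((Tor (ModuleCat.{u} R) i).obj (ModuleCat.of R M)).obj (ModuleCat.of R N)

/-- The depth of a module `M` over a local ring `R`:
`inf { i | Ext^i_R(k, M) ≠ 0 }` where `k` is the residue field, an element of `ℕ∞`
(the zero module has depth `⊤`, since the infimum of the empty set in `ℕ∞` is `⊤`). -/
noncomputable def moduleDepth (R : Type u) [CommRing R] [IsLocalRing R] (M : Type u)
    [AddCommGroup M] [Module R M] : ℕ∞ :=
  sInf {i : ℕ∞ | ∃ n : ℕ, i = (n : ℕ∞) ∧
    Nontrivial (extModule R (IsLocalRing.ResidueField R) M n)}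

/-- A module `M` is totally reflexive if the canonical evaluation map `M → M**` is bijective
and `Ext^i_R(M, R) = 0 = Ext^i_R(M*, R)` for all `i > 0`. -/
def IsTotallyReflexive (R : Type u) [CommRing R] (M : Type u)
    [AddCommGroup M] [Module R M] : Prop :=
  Function.Bijective (Module.Dual.eval R M) ∧
    (∀ i : ℕ, 0 < i → Subsingleton (extModule R M R i)) ∧
    (∀ i : ℕ, 0 < i → Subsingleton (extModule R (Module.Dual R M) R i))

/-- A module `P` has finite projective dimension iff for some `n`, `Ext^i_R(P, -)` vanishes
for all `i > n`. -/
def HasFiniteProjectiveDimension (R : Type u) [CommRing R] (P : Type u)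
    [AddCommGroup P] [Module R P] : Prop :=
  ∃ n : ℕ, ∀ (N : Type u) [AddCommGroup N] [Module R N] (i : ℕ), n < i →
    Subsingleton (extModule R P N i)

/-- A module `Q` has finite injective dimension iff for some `n`, `Ext^i_R(-, Q)` vanishes
for all `i > n`. -/
def HasFiniteInjectiveDimension (R : Type u) [CommRing R] (Q : Type u)
    [AddCommGroup Q] [Module R Q] : Prop :=
  ∃ n : ℕ, ∀ (N : Type u) [AddCommGroup N] [Module R N] (i : ℕ), n < i →
    Subsingleton (extModule R N Q i)

section ExtComparison

/-- The `Ext` modules obtained by deriving `Hom` vanish exactly when the `Ext` groups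
defined through the derived category do. -/
theorem subsingleton_extModule_iff (R : Type u) [CommRing R] (A B : Type u)
    [AddCommGroup A] [Module R A] [AddCommGroup B] [Module R B] (i : ℕ) :
    Subsingleton (extModule R A B i) ↔
      Subsingleton (Abelian.Ext (ModuleCat.of R A) (ModuleCat.of R B) i) := by
  let P := projectiveResolution (ModuleCat.of R A)
  have key : Subsingleton (extModule R A B i) ↔
      (P.complex.linearYonedaObj R (ModuleCat.of R B)).ExactAt i := by
    rw [← ModuleCat.isZero_iff_subsingleton,
      HomologicalComplex.exactAt_iff_isZero_homology]
    exact (P.isoExt i (ModuleCat.of R B)).isZero_iff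
  rw [key]
  cases i with
  | zero =>
    rw [HomologicalComplex.exactAt_iff' _ 0 0 1 (by simp) (by simp),
      ShortComplex.moduleCat_exact_iff]
    change (∀ f : P.complex.X 0 ⟶ ModuleCat.of R B, P.complex.d 1 0 ≫ f = 0 →
      ∃ g : P.complex.X 0 ⟶ ModuleCat.of R B, P.complex.d 0 0 ≫ g = f) ↔ _
    rw [Abelian.Ext.addEquiv₀.toEquiv.subsingleton_congr]
    have hd : P.complex.d 0 0 = 0 := P.complex.shape 0 0 (by simp)
    obtain ⟨π, hπ, hdπ, hdesc⟩ : ∃ π : P.complex.X 0 ⟶ ModuleCat.of R A, Epi π ∧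
        P.complex.d 1 0 ≫ π = 0 ∧ ∀ f : P.complex.X 0 ⟶ ModuleCat.of R B,
          P.complex.d 1 0 ≫ f = 0 → ∃ g : ModuleCat.of R A ⟶ ModuleCat.of R B, π ≫ g = f :=
      ⟨P.π.f 0, inferInstanceAs (Epi (P.π.f 0)), P.complex_d_comp_π_f_zero,
        fun f hf => ⟨P.exact₀.desc f hf, P.exact₀.g_desc f hf⟩⟩
    constructor
    · intro h
      refine subsingleton_of_forall_eq 0 fun x => ?_
      obtain ⟨g, hg⟩ := h (π ≫ x) (by rw [← Category.assoc, hdπ, Limits.zero_comp])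
      rw [hd, Limits.zero_comp] at hg
      exact Limits.zero_of_epi_comp π hg.symm
    · intro h f hf
      obtain ⟨g, rfl⟩ := hdesc f hf
      exact ⟨0, by rw [Subsingleton.elim (α := ModuleCat.of R A ⟶ ModuleCat.of R B) g 0,
        Limits.comp_zero, Limits.comp_zero]⟩
  | succ i =>
    rw [HomologicalComplex.exactAt_iff' _ i (i + 1) (i + 2) (by simp) (by simp),
      ShortComplex.moduleCat_exact_iff]
    change (∀ f : P.complex.X (i + 1) ⟶ ModuleCat.of R B, P.complex.d (i + 2) (i + 1) ≫ f = 0 →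
      ∃ g : P.complex.X i ⟶ ModuleCat.of R B, P.complex.d (i + 1) i ≫ g = f) ↔ _
    constructor
    · intro h
      refine subsingleton_of_forall_eq 0 fun x => ?_
      obtain ⟨f, hf, rfl⟩ := P.extMk_surjective x (i + 2) rfl
      exact (P.extMk_eq_zero_iff f _ rfl hf i rfl).2 (h f hf)
    · intro h f hf
      exact (P.extMk_eq_zero_iff f _ rfl hf i rfl).1 (Subsingleton.elim _ _)

end ExtComparison

section Depth

variable {R : Type u} [CommRing R]

/-- An exact sequence `0 → A → B → C → 0` of modules is a short exact sequence in the category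
of modules. -/
theorem shortExact_of_exact {A B C : Type u} [AddCommGroup A] [Module R A]
    [AddCommGroup B] [Module R B] [AddCommGroup C] [Module R C]
    {f : A →ₗ[R] B} {g : B →ₗ[R] C} (hf : Function.Injective f) (hg : Function.Surjective g)
    (hfg : Function.Exact f g) :
    (ShortComplex.mk (ModuleCat.ofHom f) (ModuleCat.ofHom g)
      (by rw [← ModuleCat.ofHom_comp, hfg.linearMap_comp_eq_zero]; rfl)).ShortExact :=
  ModuleCat.shortComplex_shortExact _ hfg hf hg

variable [IsLocalRing R]

theorem le_moduleDepth_iff {A : Type u} [AddCommGroup A] [Module R A] {t : ℕ} :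
    (t : ℕ∞) ≤ moduleDepth R A ↔ ∀ i < t, Subsingleton
      (Abelian.Ext (ModuleCat.of R (IsLocalRing.ResidueField R)) (ModuleCat.of R A) i) := by
  simp only [moduleDepth, le_sInf_iff, Set.mem_ofPred_eq]
  constructor
  · intro h i hi
    by_contra hn
    rw [← subsingleton_extModule_iff, not_subsingleton_iff_nontrivial] at hn
    exact absurd (h _ ⟨i, rfl, hn⟩) (by simpa using hi)
  · rintro h _ ⟨i, rfl, hi⟩
    by_contra hlt
    have := (subsingleton_extModule_iff R _ A i).2 (h i (by simpa using hlt))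
    exact not_subsingleton _ this

section ShortExactSequence

variable {A B C : Type u} [AddCommGroup A] [Module R A]
  [AddCommGroup B] [Module R B] [AddCommGroup C] [Module R C]
  {f : A →ₗ[R] B} {g : B →ₗ[R] C}

theorem le_moduleDepth_middle (hf : Function.Injective f) (hg : Function.Surjective g)
    (hfg : Function.Exact f g) {t : ℕ} (hA : (t : ℕ∞) ≤ moduleDepth R A)
    (hC : (t : ℕ∞) ≤ moduleDepth R C) : (t : ℕ∞) ≤ moduleDepth R B := by
  rw [le_moduleDepth_iff] at *
  intro i hi
  have := hA i hi
  have := hC i hi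
  refine subsingleton_of_forall_eq 0 fun x => ?_
  obtain ⟨y, rfl⟩ := Abelian.Ext.covariant_sequence_exact₂ _
    (shortExact_of_exact hf hg hfg) x
    (Subsingleton.elim (α := Abelian.Ext _ (ModuleCat.of R C) i) _ _)
  rw [Subsingleton.elim (α := Abelian.Ext _ (ModuleCat.of R A) i) y 0, Abelian.Ext.zero_comp]

theorem le_moduleDepth_right (hf : Function.Injective f) (hg : Function.Surjective g)
    (hfg : Function.Exact f g) {t : ℕ} (hA : ((t + 1 : ℕ) : ℕ∞) ≤ moduleDepth R A)
    (hB : (t : ℕ∞) ≤ moduleDepth R B) : (t : ℕ∞) ≤ moduleDepth R C := by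
  rw [le_moduleDepth_iff] at *
  intro i hi
  have := hA (i + 1) (by lia)
  have := hB i hi
  refine subsingleton_of_forall_eq 0 fun x => ?_
  obtain ⟨y, rfl⟩ := Abelian.Ext.covariant_sequence_exact₃ _
    (shortExact_of_exact hf hg hfg) x rfl
    (Subsingleton.elim (α := Abelian.Ext _ (ModuleCat.of R A) (i + 1)) _ _)
  rw [Subsingleton.elim (α := Abelian.Ext _ (ModuleCat.of R B) i) y 0, Abelian.Ext.zero_comp]

theorem le_moduleDepth_left (hf : Function.Injective f) (hg : Function.Surjective g)
    (hfg : Function.Exact f g) {t : ℕ} (hB : ((t + 1 : ℕ) : ℕ∞) ≤ moduleDepth R B)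
    (hC : (t : ℕ∞) ≤ moduleDepth R C) : ((t + 1 : ℕ) : ℕ∞) ≤ moduleDepth R A := by
  rw [le_moduleDepth_iff] at *
  intro i hi
  have := hB i hi
  refine subsingleton_of_forall_eq 0 fun x => ?_
  have hx := Subsingleton.elim (α := Abelian.Ext _ (ModuleCat.of R B) i)
    (x.comp (Abelian.Ext.mk₀ (ModuleCat.ofHom f)) (add_zero i)) 0
  cases i with
  | zero =>
    have := ((ModuleCat.mono_iff_injective (ModuleCat.ofHom f)).2 hf)
    exact Abelian.Ext.postcomp_mk₀_injective_of_mono _ (ModuleCat.ofHom f) (by simpa using hx)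
  | succ i =>
    have := hC i (by lia)
    obtain ⟨y, rfl⟩ := Abelian.Ext.covariant_sequence_exact₁ _
      (shortExact_of_exact hf hg hfg) x hx rfl
    rw [Subsingleton.elim (α := Abelian.Ext _ (ModuleCat.of R C) i) y 0, Abelian.Ext.zero_comp]

end ShortExactSequence

theorem le_moduleDepth_fin_fun {A : Type u} [AddCommGroup A] [Module R A] {t : ℕ}
    (h : (t : ℕ∞) ≤ moduleDepth R A) (r : ℕ) : (t : ℕ∞) ≤ moduleDepth R (Fin r → A) := by
  rw [le_moduleDepth_iff] at *
  intro i hi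
  have := h i hi
  refine subsingleton_of_forall_eq 0 fun x => ?_
  have hid : (𝟙 (ModuleCat.of R (Fin r → A))) =
      ∑ j, ModuleCat.ofHom (LinearMap.proj j) ≫
        ModuleCat.ofHom (LinearMap.single R (fun _ => A) j) := by
    ext x k
    simp [ModuleCat.hom_sum, Pi.single_apply]
  rw [← Abelian.Ext.comp_mk₀_id x, hid, Abelian.Ext.mk₀_sum, Abelian.Ext.comp_sum]
  refine Finset.sum_eq_zero fun j _ => ?_
  rw [← Abelian.Ext.mk₀_comp_mk₀, ← Abelian.Ext.comp_assoc_of_second_deg_zero,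
    Subsingleton.elim (α := Abelian.Ext _ (ModuleCat.of R A) i)
      (x.comp (Abelian.Ext.mk₀ (ModuleCat.ofHom (LinearMap.proj j))) (add_zero i)) 0,
    Abelian.Ext.zero_comp]

theorem le_moduleDepth_of_retract {A B : Type u} [AddCommGroup A] [Module R A]
    [AddCommGroup B] [Module R B] {t : ℕ} (s : A →ₗ[R] B) (p : B →ₗ[R] A)
    (hps : p ∘ₗ s = LinearMap.id) (h : (t : ℕ∞) ≤ moduleDepth R B) :
    (t : ℕ∞) ≤ moduleDepth R A := by
  rw [le_moduleDepth_iff] at *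
  intro i hi
  have := h i hi
  refine subsingleton_of_forall_eq 0 fun x => ?_
  have hid : 𝟙 (ModuleCat.of R A) = ModuleCat.ofHom s ≫ ModuleCat.ofHom p := by
    rw [← ModuleCat.ofHom_comp, hps]; rfl
  rw [← Abelian.Ext.comp_mk₀_id x, hid, ← Abelian.Ext.mk₀_comp_mk₀,
    ← Abelian.Ext.comp_assoc_of_second_deg_zero,
    Subsingleton.elim (α := Abelian.Ext _ (ModuleCat.of R B) i)
      (x.comp (Abelian.Ext.mk₀ (ModuleCat.ofHom s)) (add_zero i)) 0,
    Abelian.Ext.zero_comp]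

theorem moduleDepth_congr {A B : Type u} [AddCommGroup A] [Module R A]
    [AddCommGroup B] [Module R B] (e : A ≃ₗ[R] B) : moduleDepth R A = moduleDepth R B :=
  ENat.eq_of_forall_natCast_le_iff fun _ =>
    ⟨le_moduleDepth_of_retract e.symm.toLinearMap e.toLinearMap (by ext; simp),
      le_moduleDepth_of_retract e.toLinearMap e.symm.toLinearMap (by ext; simp)⟩

end Depth

section MinimalCover

variable {R : Type u} [CommRing R]

open IsLocalRing TensorProduct

/-- A map from a free module with image in `I F` lies in `I Hom(G, F)`. -/
theorem mem_smul_top_of_range_le {G F : Type*} [AddCommGroup G] [Module R G]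
    [AddCommGroup F] [Module R F] [Module.Free R G] [Module.Finite R G] {I : Ideal R}
    (j : G →ₗ[R] F) (hj : LinearMap.range j ≤ I • ⊤) :
    j ∈ I • (⊤ : Submodule R (G →ₗ[R] F)) := by
  let b := Module.Free.chooseBasis R G
  have hj' : j = ∑ i, LinearMap.smulRightₗ (b.coord i) (j (b i)) := by
    refine b.ext fun k => ?_
    simp [LinearMap.sum_apply, Finsupp.single_apply]
  rw [hj']
  refine Submodule.sum_mem _ fun i _ => ?_
  have h := Submodule.mem_map_of_mem (f := LinearMap.smulRightₗ (b.coord i))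
    (hj (LinearMap.mem_range_self j (b i)))
  rw [Submodule.map_smul''] at h
  exact Submodule.smul_mono le_rfl le_top h

theorem rTensor_mem_smul_top {G F : Type*} (N : Type*) [AddCommGroup G] [Module R G]
    [AddCommGroup F] [Module R F] [AddCommGroup N] [Module R N] {I : Ideal R}
    {j : G →ₗ[R] F} (hj : j ∈ I • (⊤ : Submodule R (G →ₗ[R] F))) :
    j.rTensor N ∈ I • (⊤ : Submodule R (G ⊗[R] N →ₗ[R] F ⊗[R] N)) := by
  have h := Submodule.mem_map_of_mem (f := LinearMap.rTensorHom N) hj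
  rw [Submodule.map_smul''] at h
  exact Submodule.smul_mono le_rfl le_top h

variable [IsLocalRing R]

/-- A finitely generated module over a local ring has a minimal free cover. -/
theorem exists_minimal_free_cover (P : Type u) [AddCommGroup P] [Module R P]
    [Module.Finite R P] :
    ∃ (r : ℕ) (g : (Fin r → R) →ₗ[R] P), Function.Surjective g ∧
      LinearMap.ker g ≤ maximalIdeal R • (⊤ : Submodule R (Fin r → R)) := by
  let b := Module.finBasis (ResidueField R) (ResidueField R ⊗[R] P)
  choose v hv using fun i => TensorProduct.mk_surjective R P (ResidueField R)
    Ideal.Quotient.mk_surjective (b i)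
  refine ⟨_, Fintype.linearCombination R v, ?_, fun x hx => ?_⟩
  · rw [← LinearMap.range_eq_top, Fintype.range_linearCombination]
    exact span_eq_top_of_tmul_eq_basis v b hv
  · have hx0 : ∑ i, residue R (x i) • b i = 0 := by
      have h := congrArg (TensorProduct.mk R (ResidueField R) P 1) (LinearMap.mem_ker.1 hx)
      rw [Fintype.linearCombination_apply, map_sum, map_zero] at h
      rw [← h]
      refine Finset.sum_congr rfl fun i _ => ?_
      rw [map_smul, hv i]
      exact algebraMap_smul (ResidueField R) (x i) (b i)
    have hmem : ∀ i, x i ∈ maximalIdeal R := fun i =>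
      (residue_eq_zero_iff _).1 (Fintype.linearIndependent_iff.1 b.linearIndependent _ hx0 i)
    rw [pi_eq_sum_univ' x]
    exact Submodule.sum_mem _ fun i _ =>
      Submodule.smul_mem_smul (hmem i) Submodule.mem_top

/-- Maps in `𝔪 Hom(A, B)` induce zero on `Ext(k, -)`. -/
theorem ext_residueField_comp_eq_zero {A B : Type u} [AddCommGroup A] [Module R A]
    [AddCommGroup B] [Module R B] {φ : A →ₗ[R] B}
    (hφ : φ ∈ maximalIdeal R • (⊤ : Submodule R (A →ₗ[R] B))) {i : ℕ}
    (x : Abelian.Ext (ModuleCat.of R (ResidueField R)) (ModuleCat.of R A) i) :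
    x.comp (Abelian.Ext.mk₀ (ModuleCat.ofHom φ)) (add_zero i) = 0 := by
  induction hφ using Submodule.smul_induction_on' with
  | smul r hr ψ _ =>
    have hann : r ∈ Module.annihilator R (ModuleCat.of R (ResidueField R)) := by
      rw [Module.mem_annihilator]
      intro y
      change r • (y : ResidueField R) = 0
      rw [Algebra.smul_def, ResidueField.algebraMap_eq, (residue_eq_zero_iff r).2 hr, zero_mul]
    have h := DFunLike.congr_fun (congrArg AddCommGrpCat.Hom.hom
      (Abelian.Ext.postcomp_smul_id_eq_zero_of_mem_annihilator
      (M := ModuleCat.of R A) hann i)) x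
    have h' : x.comp (Abelian.Ext.mk₀ (r • 𝟙 (ModuleCat.of R A))) (add_zero i) = 0 := h
    rw [← Abelian.Ext.smul_eq_comp_mk₀] at h'
    rw [show ModuleCat.ofHom (r • ψ) = r • ModuleCat.ofHom ψ from rfl, Abelian.Ext.mk₀_smul,
      Abelian.Ext.comp_smul,
      ← Abelian.Ext.smul_comp, h', Abelian.Ext.zero_comp]
  | add φ _ ψ _ h₁ h₂ =>
    rw [ModuleCat.ofHom_add, Abelian.Ext.mk₀_add, Abelian.Ext.comp_add, h₁, h₂, add_zero]

/-- The cokernel of an injective map `A → B` in `𝔪 Hom(A, B)` has depth one less than `A`, if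
`B` is at least as deep as `A`. -/
theorem moduleDepth_add_one_of_mem_smul {A B C : Type u} [AddCommGroup A] [Module R A]
    [AddCommGroup B] [Module R B] [AddCommGroup C] [Module R C]
    {f : A →ₗ[R] B} {g : B →ₗ[R] C} (hf : Function.Injective f) (hg : Function.Surjective g)
    (hfg : Function.Exact f g) (hmem : f ∈ maximalIdeal R • (⊤ : Submodule R (A →ₗ[R] B)))
    (hA : moduleDepth R A ≠ ⊤) (hAB : moduleDepth R A ≤ moduleDepth R B) :
    moduleDepth R C + 1 = moduleDepth R A := by
  obtain ⟨t, ht⟩ := ENat.ne_top_iff_exists.1 hA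
  rw [← ht] at hAB ⊢
  have htA : ¬ ((t + 1 : ℕ) : ℕ∞) ≤ moduleDepth R A := by
    rw [← ht]; exact_mod_cast Nat.not_succ_le_self t
  cases t with
  | zero =>
    refine absurd (le_moduleDepth_iff.2 fun i hi => ?_) htA
    obtain rfl : i = 0 := by lia
    have := (ModuleCat.mono_iff_injective (ModuleCat.ofHom f)).2 hf
    refine subsingleton_of_forall_eq 0 fun x => ?_
    exact Abelian.Ext.postcomp_mk₀_injective_of_mono _ (ModuleCat.ofHom f)
      (by simpa using ext_residueField_comp_eq_zero hmem x)
  | succ t =>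
    have h1 : (t : ℕ∞) ≤ moduleDepth R C := le_moduleDepth_right hf hg hfg ht.le
      (le_trans (by exact_mod_cast Nat.le_succ t) hAB)
    have h2 : ¬ ((t + 1 : ℕ) : ℕ∞) ≤ moduleDepth R C := by
      intro hC
      refine htA (le_moduleDepth_iff.2 fun i hi => subsingleton_of_forall_eq 0 fun x => ?_)
      obtain _ | i := i
      · have := (ModuleCat.mono_iff_injective (ModuleCat.ofHom f)).2 hf
        exact Abelian.Ext.postcomp_mk₀_injective_of_mono _ (ModuleCat.ofHom f)
          (by simpa using ext_residueField_comp_eq_zero hmem x)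
      · have := le_moduleDepth_iff.1 hC i (by lia)
        obtain ⟨y, rfl⟩ := Abelian.Ext.covariant_sequence_exact₁ _
          (shortExact_of_exact hf hg hfg) x (ext_residueField_comp_eq_zero hmem x) rfl
        rw [Subsingleton.elim (α := Abelian.Ext _ (ModuleCat.of R C) i) y 0,
          Abelian.Ext.zero_comp]
    have h3 : moduleDepth R C = t := by
      refine le_antisymm ?_ h1
      exact Order.le_of_lt_add_one (by simpa using h2)
    rw [h3]; rfl

end MinimalCover

section Tor

open TensorProduct

variable {R : Type u} [CommRing R]

section Chase

variable {A B C : Type*} [AddCommGroup A] [Module R A] [AddCommGroup B] [Module R B]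
  [AddCommGroup C] [Module R C] {f : A →ₗ[R] B} {g : B →ₗ[R] C}
  {Q₀ Q₁ Q₂ : Type*} [AddCommGroup Q₀] [Module R Q₀] [AddCommGroup Q₁] [Module R Q₁]
  [AddCommGroup Q₂] [Module R Q₂] {d₂ : Q₂ →ₗ[R] Q₁} {d₁ : Q₁ →ₗ[R] Q₀}

theorem lTensor_rTensor_apply {A B Q Q' : Type*} [AddCommGroup A] [Module R A]
    [AddCommGroup B] [Module R B] [AddCommGroup Q] [Module R Q] [AddCommGroup Q'] [Module R Q']
    (f : A →ₗ[R] B) (d : Q →ₗ[R] Q') (x : A ⊗[R] Q) :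
    d.lTensor B (f.rTensor Q x) = f.rTensor Q' (d.lTensor A x) := by
  rw [← LinearMap.comp_apply, ← LinearMap.comp_apply, LinearMap.lTensor_comp_rTensor,
    LinearMap.rTensor_comp_lTensor]

theorem lTensor_lTensor_eq_zero (A : Type*) [AddCommGroup A] [Module R A]
    (hd : d₁ ∘ₗ d₂ = 0) (x : A ⊗[R] Q₂) : d₁.lTensor A (d₂.lTensor A x) = 0 := by
  rw [← LinearMap.comp_apply, ← LinearMap.lTensor_comp, hd, LinearMap.lTensor_zero,
    LinearMap.zero_apply]

/-- Exactness of `X ⊗ Q` in the middle spot is inherited by extensions. -/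
theorem lTensor_exact_middle (hf : Function.Injective f) (hg : Function.Surjective g)
    (hfg : Function.Exact f g) [Module.Flat R Q₀] (hd : d₁ ∘ₗ d₂ = 0)
    (hA : Function.Exact (d₂.lTensor A) (d₁.lTensor A))
    (hC : Function.Exact (d₂.lTensor C) (d₁.lTensor C)) :
    Function.Exact (d₂.lTensor B) (d₁.lTensor B) := by
  intro b
  refine ⟨fun hb => ?_, ?_⟩
  · obtain ⟨c', hc'⟩ := (hC (g.rTensor Q₁ b)).1 (by rw [lTensor_rTensor_apply, hb, map_zero])
    obtain ⟨b', rfl⟩ := LinearMap.rTensor_surjective Q₂ hg c'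
    obtain ⟨a, ha⟩ := (rTensor_exact Q₁ hfg hg (b - d₂.lTensor B b')).1
      (by rw [map_sub, ← hc', lTensor_rTensor_apply, sub_self])
    obtain ⟨a', rfl⟩ := (hA a).1 (Module.Flat.rTensor_preserves_injective_linearMap
      (M := Q₀) f hf (by
        rw [← lTensor_rTensor_apply, ha, map_sub, hb, lTensor_lTensor_eq_zero B hd, map_zero,
          sub_zero]))
    exact ⟨f.rTensor Q₂ a' + b', by
      rw [map_add, lTensor_rTensor_apply, ha, sub_add_cancel]⟩
  · rintro ⟨b', rfl⟩
    exact lTensor_lTensor_eq_zero B hd b'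

/-- If `C ⊗ Q` is exact in the middle spot, then boundaries of `B ⊗ Q` which lie in `A ⊗ Q`
are boundaries of `A ⊗ Q`. -/
theorem mem_range_of_rTensor_mem_range (hf : Function.Injective f) (hg : Function.Surjective g)
    (hfg : Function.Exact f g) [Module.Flat R Q₀] (hd : d₁ ∘ₗ d₂ = 0)
    (hC : Function.Exact (d₂.lTensor C) (d₁.lTensor C)) (a : A ⊗[R] Q₀)
    (ha : f.rTensor Q₀ a ∈ Set.range (d₁.lTensor B)) : a ∈ Set.range (d₁.lTensor A) := by
  obtain ⟨b, hb⟩ := ha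
  obtain ⟨c, hc⟩ := (hC (g.rTensor Q₁ b)).1 (by
    rw [lTensor_rTensor_apply, hb]
    exact (rTensor_exact Q₀ hfg hg).apply_apply_eq_zero a)
  obtain ⟨b', rfl⟩ := LinearMap.rTensor_surjective Q₂ hg c
  obtain ⟨a', ha'⟩ := (rTensor_exact Q₁ hfg hg (b - d₂.lTensor B b')).1
    (by rw [map_sub, ← hc, lTensor_rTensor_apply, sub_self])
  refine ⟨a', Module.Flat.rTensor_preserves_injective_linearMap (M := Q₀) f hf ?_⟩
  rw [← lTensor_rTensor_apply, ha', map_sub, hb, lTensor_lTensor_eq_zero B hd, sub_zero]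

end Chase

/-- The differential of the chosen projective resolution of `N`. -/
noncomputable abbrev resolutionD (N : Type u) [AddCommGroup N] [Module R N] (i : ℕ) :
    (projectiveResolution (ModuleCat.of R N)).complex.X (i + 1) →ₗ[R]
      (projectiveResolution (ModuleCat.of R N)).complex.X i :=
  ((projectiveResolution (ModuleCat.of R N)).complex.d (i + 1) i).hom

variable (N : Type u) [AddCommGroup N] [Module R N]

theorem resolutionD_comp (i : ℕ) :
    resolutionD (R := R) N i ∘ₗ resolutionD (R := R) N (i + 1) = 0 := by
  have := (projectiveResolution (ModuleCat.of R N)).complex.d_comp_d (i + 1 + 1) (i + 1) i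
  exact congrArg ModuleCat.Hom.hom this

instance flat_resolution (i : ℕ) :
    Module.Flat R ((projectiveResolution (ModuleCat.of R N)).complex.X i) := by
  have : Module.Projective R ((projectiveResolution (ModuleCat.of R N)).complex.X i) :=
    (IsProjective.iff_projective _).2
      ((projectiveResolution (ModuleCat.of R N)).projective i)
  infer_instance

theorem resolutionD_exact (i : ℕ) :
    Function.Exact (resolutionD (R := R) N (i + 1)) (resolutionD (R := R) N i) := by
  have h := (projectiveResolution (ModuleCat.of R N)).complex_exactAt_succ i
  rw [HomologicalComplex.exactAt_iff' _ (i + 1 + 1) (i + 1) i (by simp) (by simp),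
    ShortComplex.ShortExact.moduleCat_exact_iff_function_exact] at h
  exact h

/-- `Tor` vanishes exactly when tensoring the resolution is exact. -/
theorem subsingleton_torModule_succ_iff (A : Type u) [AddCommGroup A] [Module R A] (i : ℕ) :
    Subsingleton (torModule R A N (i + 1)) ↔
      Function.Exact ((resolutionD (R := R) N (i + 1)).lTensor A)
        ((resolutionD (R := R) N i).lTensor A) := by
  let P := projectiveResolution (ModuleCat.of R N)
  let F := (MonoidalCategory.tensoringLeft (ModuleCat.{u} R)).obj (ModuleCat.of R A)
  have key : Subsingleton (torModule R A N (i + 1)) ↔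
      ((F.mapHomologicalComplex _).obj P.complex).ExactAt (i + 1) := by
    rw [← ModuleCat.isZero_iff_subsingleton,
      HomologicalComplex.exactAt_iff_isZero_homology]
    exact (P.isoLeftDerivedObj F (i + 1)).isZero_iff
  rw [key, HomologicalComplex.exactAt_iff' _ (i + 1 + 1) (i + 1) i (by simp) (by simp),
    ShortComplex.ShortExact.moduleCat_exact_iff_function_exact]
  rfl

variable {N}

theorem subsingleton_torModule_of_flat (A : Type u) [AddCommGroup A] [Module R A]
    [Module.Flat R A] {i : ℕ} (hi : 1 ≤ i) : Subsingleton (torModule R A N i) := by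
  obtain ⟨i, rfl⟩ := Nat.exists_eq_add_of_le' hi
  exact (subsingleton_torModule_succ_iff N A i).2
    (Module.Flat.lTensor_exact A (resolutionD_exact N i))

theorem subsingleton_torModule_self (A : Type u) [AddCommGroup A] [Module R A] {i : ℕ}
    (hi : 1 ≤ i) : Subsingleton (torModule R A R i) := by
  obtain ⟨i, rfl⟩ := Nat.exists_eq_add_of_le' hi
  have : Projective (ModuleCat.of R R) := (IsProjective.iff_projective R).1 inferInstance
  exact ModuleCat.isZero_iff_subsingleton.1 
    (isZero_Tor_succ_of_projective _ (ModuleCat.of R A) (ModuleCat.of R R) i)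

variable {A B C : Type u} [AddCommGroup A] [Module R A] [AddCommGroup B] [Module R B]
  [AddCommGroup C] [Module R C] {f : A →ₗ[R] B} {g : B →ₗ[R] C}

theorem subsingleton_torModule_middle (hf : Function.Injective f) (hg : Function.Surjective g)
    (hfg : Function.Exact f g) {i : ℕ} (hi : 1 ≤ i) (hA : Subsingleton (torModule R A N i))
    (hC : Subsingleton (torModule R C N i)) : Subsingleton (torModule R B N i) := by
  obtain ⟨i, rfl⟩ := Nat.exists_eq_add_of_le' hi
  rw [subsingleton_torModule_succ_iff] at *
  exact lTensor_exact_middle hf hg hfg (resolutionD_comp N i) hA hC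

theorem subsingleton_torModule_left (hf : Function.Injective f) (hg : Function.Surjective g)
    (hfg : Function.Exact f g) {i : ℕ} (hi : 1 ≤ i) (hB : Subsingleton (torModule R B N i))
    (hC : Subsingleton (torModule R C N (i + 1))) : Subsingleton (torModule R A N i) := by
  obtain ⟨i, rfl⟩ := Nat.exists_eq_add_of_le' hi
  rw [subsingleton_torModule_succ_iff] at *
  intro a
  refine ⟨fun ha => ?_, ?_⟩
  · exact mem_range_of_rTensor_mem_range hf hg hfg (resolutionD_comp N (i + 1)) hC a
      ((hB _).1 (by rw [lTensor_rTensor_apply, ha, map_zero]))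
  · rintro ⟨a, rfl⟩
    exact lTensor_lTensor_eq_zero A (resolutionD_comp N i) a

theorem rTensor_injective_of_subsingleton_torModule (hf : Function.Injective f)
    (hg : Function.Surjective g) (hfg : Function.Exact f g)
    (hC : Subsingleton (torModule R C N 1)) : Function.Injective (f.rTensor N) := by
  rw [subsingleton_torModule_succ_iff] at hC
  let P := projectiveResolution (ModuleCat.of R N)
  obtain ⟨ε, hε, hdε⟩ : ∃ ε : P.complex.X 0 →ₗ[R] N, Function.Surjective ε ∧
      Function.Exact (resolutionD (R := R) N 0) ε := by
    refine ⟨(P.π.f 0).hom, (ModuleCat.epi_iff_surjective _).1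
      (inferInstanceAs (Epi (P.π.f 0))), ?_⟩
    exact (ShortComplex.ShortExact.moduleCat_exact_iff_function_exact _).1 P.exact₀
  rw [injective_iff_map_eq_zero]
  intro y hy
  obtain ⟨a, rfl⟩ := LinearMap.lTensor_surjective A hε y
  rw [← lTensor_rTensor_apply] at hy
  obtain ⟨a, rfl⟩ := mem_range_of_rTensor_mem_range hf hg hfg (resolutionD_comp N 0) hC a
    ((lTensor_exact B hdε hε _).1 hy)
  exact (lTensor_exact A hdε hε).apply_apply_eq_zero a

end Tor

section AuslanderFormula

open TensorProduct

variable {R : Type u} [CommRing R]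

theorem subsingleton_extModule_left {A B C Y : Type u} [AddCommGroup A] [Module R A]
    [AddCommGroup B] [Module R B] [AddCommGroup C] [Module R C] [AddCommGroup Y] [Module R Y]
    {f : A →ₗ[R] B} {g : B →ₗ[R] C} (hf : Function.Injective f) (hg : Function.Surjective g)
    (hfg : Function.Exact f g) [Module.Projective R B] {i : ℕ} (hi : 1 ≤ i)
    (hC : Subsingleton (extModule R C Y (i + 1))) : Subsingleton (extModule R A Y i) := by
  rw [subsingleton_extModule_iff] at *
  obtain ⟨i, rfl⟩ := Nat.exists_eq_add_of_le' hi
  refine subsingleton_of_forall_eq 0 fun x => ?_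
  obtain ⟨y, rfl⟩ := Abelian.Ext.contravariant_sequence_exact₁
    (shortExact_of_exact hf hg hfg) (ModuleCat.of R Y) x (add_comm 1 (i + 1))
    (Subsingleton.elim (α := Abelian.Ext (ModuleCat.of R C) _ _) _ _)
  have := (IsProjective.iff_projective (R := R) B).1 inferInstance
  rw [Abelian.Ext.eq_zero_of_projective (P := ModuleCat.of R B) y, Abelian.Ext.comp_zero]

theorem exists_tensor_equiv_fin_fun (F N : Type*) [AddCommGroup F] [Module R F]
    [Module.Free R F] [Module.Finite R F] [AddCommGroup N] [Module R N] [Nontrivial R] :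
    Nonempty (F ⊗[R] N ≃ₗ[R] (Fin (Module.finrank R F) → N)) :=
  ⟨(LinearEquiv.rTensor N (Module.finBasis R F).equivFun).trans
    ((TensorProduct.comm R _ N).trans (TensorProduct.piScalarRight R R N _))⟩

variable [IsLocalRing R]

theorem le_moduleDepth_tensor_of_free (F N : Type u) [AddCommGroup F] [Module R F]
    [Module.Free R F] [Module.Finite R F] [AddCommGroup N] [Module R N] :
    moduleDepth R N ≤ moduleDepth R (F ⊗[R] N) := by
  obtain ⟨e⟩ := exists_tensor_equiv_fin_fun (R := R) F N
  rw [moduleDepth_congr e]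
  exact ENat.forall_natCast_le_iff_le.1 fun t ht => le_moduleDepth_fin_fun ht _

theorem moduleDepth_tensor_of_free (F N : Type u) [AddCommGroup F] [Module R F]
    [Module.Free R F] [Module.Finite R F] [Nontrivial F] [AddCommGroup N] [Module R N] :
    moduleDepth R (F ⊗[R] N) = moduleDepth R N := by
  refine le_antisymm ?_ (le_moduleDepth_tensor_of_free F N)
  obtain ⟨e⟩ := exists_tensor_equiv_fin_fun (R := R) F N
  rw [moduleDepth_congr e]
  have i₀ : Fin (Module.finrank R F) := (Module.finBasis R F).index_nonempty.some
  exact ENat.forall_natCast_le_iff_le.1 fun t ht =>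
    le_moduleDepth_of_retract (LinearMap.single R (fun _ => N) i₀) (LinearMap.proj i₀)
      (by ext; simp) ht

section ShortExactSequence

variable {A B C : Type u} [AddCommGroup A] [Module R A]
  [AddCommGroup B] [Module R B] [AddCommGroup C] [Module R C]
  {f : A →ₗ[R] B} {g : B →ₗ[R] C}

theorem moduleDepth_add_one_of_lt (hf : Function.Injective f) (hg : Function.Surjective g)
    (hfg : Function.Exact f g) (hAB : moduleDepth R A < moduleDepth R B) :
    moduleDepth R C + 1 = moduleDepth R A := by
  obtain ⟨t, ht⟩ := ENat.ne_top_iff_exists.1 hAB.ne_top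
  have hB : ((t + 1 : ℕ) : ℕ∞) ≤ moduleDepth R B := by
    rw [← ht] at hAB; exact_mod_cast Order.add_one_le_of_lt hAB
  have htA : ¬ ((t + 1 : ℕ) : ℕ∞) ≤ moduleDepth R A := by
    rw [← ht]; exact_mod_cast Nat.not_succ_le_self t
  cases t with
  | zero => exact absurd (le_moduleDepth_left hf hg hfg hB (by simp)) htA
  | succ t =>
    have h1 : (t : ℕ∞) ≤ moduleDepth R C := le_moduleDepth_right hf hg hfg ht.le
      (le_trans (by exact_mod_cast (by lia)) hB)
    have h2 : ¬ ((t + 1 : ℕ) : ℕ∞) ≤ moduleDepth R C := fun hC =>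
      htA (le_moduleDepth_left hf hg hfg hB hC)
    have h3 : moduleDepth R C = t :=
      le_antisymm (Order.le_of_lt_add_one (by simpa using h2)) h1
    rw [h3, ← ht]; rfl

theorem moduleDepth_eq_of_lt (hf : Function.Injective f) (hg : Function.Surjective g)
    (hfg : Function.Exact f g)
    (h : moduleDepth R A < moduleDepth R C ∨ moduleDepth R B < moduleDepth R C) :
    moduleDepth R A = moduleDepth R B := by
  have key : ∀ t : ℕ, (t : ℕ∞) ≤ moduleDepth R C →
      ((t : ℕ∞) ≤ moduleDepth R A ↔ (t : ℕ∞) ≤ moduleDepth R B) := by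
    intro t ht
    refine ⟨fun hA => le_moduleDepth_middle hf hg hfg hA ht, fun hB => ?_⟩
    cases t with
    | zero => simp
    | succ t =>
      exact le_moduleDepth_left hf hg hfg hB (le_trans (by exact_mod_cast Nat.le_succ t) ht)
  have aux : ∀ x y z : ℕ∞, (∀ t : ℕ, (t : ℕ∞) ≤ z → ((t : ℕ∞) ≤ x ↔ (t : ℕ∞) ≤ y)) →
      x < z → x = y := by
    intro x y z hxy hxz
    obtain ⟨s, rfl⟩ := ENat.ne_top_iff_exists.1 hxz.ne_top
    refine le_antisymm ((hxy s hxz.le).1 le_rfl) (not_lt.1 fun hlt => ?_)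
    have := (hxy (s + 1) (by exact_mod_cast Order.add_one_le_of_lt hxz)).2
      (by exact_mod_cast Order.add_one_le_of_lt hlt)
    exact Nat.not_succ_le_self s (by exact_mod_cast this)
  rcases h with h | h
  · exact aux _ _ _ key h
  · exact (aux _ _ _ (fun t ht => (key t ht).symm) h).symm

end ShortExactSequence

/-- **Auslander's depth formula** for a module `P` of finite projective dimension: there is `p`
(the projective dimension of `P`) such that `depth (P ⊗ N) + p = depth N` for every `N` of finite
depth which is `Tor`-independent of `P`. -/
theorem exists_moduleDepth_tensor_add_eq [IsNoetherianRing R] (d : ℕ) (P : Type u)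
    [AddCommGroup P] [Module R P] [Module.Finite R P] [Nontrivial P]
    (hP : ∀ (Y : Type u) [AddCommGroup Y] [Module R Y] (i : ℕ), d < i →
      Subsingleton (extModule R P Y i)) :
    ∃ p : ℕ, (p = 0 → Module.Free R P) ∧ ∀ (N : Type u) [AddCommGroup N] [Module R N],
      moduleDepth R N ≠ ⊤ → (∀ i, 1 ≤ i → i ≤ p → Subsingleton (torModule R P N i)) →
      moduleDepth R (P ⊗[R] N) + (p : ℕ∞) = moduleDepth R N := by
  induction d generalizing P with
  | zero =>
    suffices hfree : Module.Free R P from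
      ⟨0, fun _ => hfree, fun N _ _ _ _ => by simp [moduleDepth_tensor_of_free P N]⟩
    have : Projective (ModuleCat.of R P) := projective_iff_subsingleton_ext_one.2 fun Y =>
      (subsingleton_extModule_iff R P Y 1).1 (hP Y 1 one_pos)
    have : Module.Projective R P := (IsProjective.iff_projective P).2 this
    exact Module.free_of_flat_of_isLocalRing
  | succ d ih =>
    obtain ⟨r, g, hg, hker⟩ := exists_minimal_free_cover (R := R) P
    let j := (LinearMap.ker g).subtype
    have hj : Function.Injective j := Subtype.val_injective
    have hjg : Function.Exact j g := LinearMap.exact_subtype_ker_map g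
    rcases subsingleton_or_nontrivial (LinearMap.ker g) with h0 | h0
    · have hinj : Function.Injective g :=
        LinearMap.ker_eq_bot.1 (Submodule.subsingleton_iff_eq_bot.1 h0)
      have hfree := Module.Free.of_equiv (LinearEquiv.ofBijective g ⟨hinj, hg⟩)
      exact ⟨0, fun _ => hfree, fun N _ _ _ _ => by simp [moduleDepth_tensor_of_free P N]⟩
    obtain ⟨p, hp0, hp⟩ := ih (LinearMap.ker g)
      (fun Y _ _ i hi => subsingleton_extModule_left hj hg hjg (by lia) (hP Y _ (by lia)))
    refine ⟨p + 1, by simp, fun N _ _ hN hTor => ?_⟩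
    have h1 := hp N hN fun i hi hip => subsingleton_torModule_left hj hg hjg hi
      (subsingleton_torModule_of_flat _ hi) (hTor _ (by lia) (by lia))
    have hle := le_moduleDepth_tensor_of_free (R := R) (Fin r → R) N
    have hA : moduleDepth R (LinearMap.ker g ⊗[R] N) ≠ ⊤ := fun h => hN (by rw [← h1, h]; rfl)
    have hjN := rTensor_injective_of_subsingleton_torModule hj hg hjg
      (hTor 1 le_rfl (by lia))
    have hgN := LinearMap.rTensor_surjective N hg
    have hjgN := rTensor_exact N hjg hg
    have h2 : moduleDepth R (P ⊗[R] N) + 1 = moduleDepth R (LinearMap.ker g ⊗[R] N) := by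
      rcases Nat.eq_zero_or_pos p with rfl | hpos
      · have := hp0 rfl
        refine moduleDepth_add_one_of_mem_smul hjN hgN hjgN
          (rTensor_mem_smul_top N (mem_smul_top_of_range_le j ?_)) hA ?_
        · rwa [Submodule.range_subtype]
        · exact le_trans (by rw [← h1]; simp) hle
      · refine moduleDepth_add_one_of_lt hjN hgN hjgN (lt_of_lt_of_le ?_ hle)
        rw [← h1]
        obtain ⟨s, hs⟩ := ENat.ne_top_iff_exists.1 hA
        rw [← hs]
        exact_mod_cast (by lia)
    rw [← h1, ← h2]
    push_cast
    rw [add_assoc, add_comm (p : ℕ∞) 1]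

end AuslanderFormula

section Transpose

open TensorProduct

variable {R : Type u} [CommRing R]

theorem exists_extension_of_subsingleton_extModule_one {A B C Y : Type u} [AddCommGroup A]
    [Module R A] [AddCommGroup B] [Module R B] [AddCommGroup C] [Module R C] [AddCommGroup Y]
    [Module R Y] {f : A →ₗ[R] B} {g : B →ₗ[R] C} (hf : Function.Injective f)
    (hg : Function.Surjective g) (hfg : Function.Exact f g)
    (hC : Subsingleton (extModule R C Y 1)) (h : A →ₗ[R] Y) : ∃ k : B →ₗ[R] Y, k ∘ₗ f = h := by
  rw [subsingleton_extModule_iff] at hC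
  obtain ⟨y, hy⟩ := Abelian.Ext.contravariant_sequence_exact₁
    (shortExact_of_exact hf hg hfg) (ModuleCat.of R Y)
    (Abelian.Ext.mk₀ (ModuleCat.ofHom h)) (add_zero 1)
    (Subsingleton.elim (α := Abelian.Ext (ModuleCat.of R C) _ _) _ _)
  obtain ⟨k, rfl⟩ := (Abelian.Ext.mk₀_bijective (ModuleCat.of R B) (ModuleCat.of R Y)).2 y
  refine ⟨k.hom, ?_⟩
  rw [Abelian.Ext.mk₀_comp_mk₀] at hy
  exact congrArg ModuleCat.Hom.hom
    ((Abelian.Ext.mk₀_bijective (ModuleCat.of R A) (ModuleCat.of R Y)).1 hy)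

/-- A map vanishing on the kernel of a surjection factors through it. -/
theorem exists_factor_of_exact {A B C Y : Type*} [AddCommGroup A]
    [Module R A] [AddCommGroup B] [Module R B] [AddCommGroup C] [Module R C] [AddCommGroup Y]
    [Module R Y] {f : A →ₗ[R] B} {g : B →ₗ[R] C} (hg : Function.Surjective g)
    (hfg : Function.Exact f g) {h : B →ₗ[R] Y} (hh : h ∘ₗ f = 0) :
    ∃ k : C →ₗ[R] Y, k ∘ₗ g = h := by
  have hk : LinearMap.range f ≤ LinearMap.ker h := LinearMap.range_le_ker_iff.2 hh
  refine ⟨(LinearMap.range f).liftQ h hk ∘ₗ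
    (hfg.linearEquivOfSurjective hg).symm.toLinearMap, ?_⟩
  ext b
  have : (hfg.linearEquivOfSurjective hg).symm (g b) = (LinearMap.range f).mkQ b := by
    rw [LinearEquiv.symm_apply_eq]; rfl
  simp [this]

theorem exists_fin_free_cover_exact [IsNoetherianRing R] {G Y : Type*} [AddCommGroup G]
    [Module R G] [Module.Finite R G] [AddCommGroup Y] [Module R Y] (φ : G →ₗ[R] Y) :
    ∃ (r : ℕ) (ψ : (Fin r → R) →ₗ[R] G), Function.Exact ψ φ := by
  obtain ⟨r, ψ, hψ⟩ := Module.Finite.exists_fin' R (LinearMap.ker φ)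
  refine ⟨r, (LinearMap.ker φ).subtype ∘ₗ ψ, LinearMap.exact_iff.2 ?_⟩
  rw [LinearMap.range_comp, LinearMap.range_eq_top.2 hψ, Submodule.map_top,
    Submodule.range_subtype]

variable [IsLocalRing R]

theorem le_moduleDepth_hom_of_free (F N : Type u) [AddCommGroup F] [Module R F]
    [Module.Free R F] [Module.Finite R F] [AddCommGroup N] [Module R N] :
    moduleDepth R N ≤ moduleDepth R (F →ₗ[R] N) := by
  rw [← moduleDepth_congr ((Module.finBasis R F).constr R (M' := N))]
  exact ENat.forall_natCast_le_iff_le.1 fun t ht => le_moduleDepth_fin_fun ht _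

theorem le_moduleDepth_left_of_le {A B C : Type u} [AddCommGroup A] [Module R A]
    [AddCommGroup B] [Module R B] [AddCommGroup C] [Module R C] {f : A →ₗ[R] B} {g : B →ₗ[R] C}
    (hf : Function.Injective f) (hg : Function.Surjective g)
    (hfg : Function.Exact f g) {t : ℕ} (hB : (t : ℕ∞) ≤ moduleDepth R B)
    (hC : (t : ℕ∞) ≤ moduleDepth R C) : (t : ℕ∞) ≤ moduleDepth R A := by
  cases t with
  | zero => simp
  | succ t =>
    exact le_moduleDepth_left hf hg hfg hB (le_trans (by exact_mod_cast Nat.le_succ t) hC)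

variable [IsNoetherianRing R]

/-- If `Ext^j(Z, N) = 0` for `1 ≤ j ≤ t` and `t ≤ depth N`, and `G₀ → G₁ → Z → 0` is a free
presentation, then the cokernel of `Hom(G₁, N) → Hom(G₀, N)` has depth at least `t`. -/
theorem le_moduleDepth_quotient_range_lcomp {N : Type u} [AddCommGroup N] [Module R N] (t : ℕ)
    {G₀ G₁ Z : Type u} [AddCommGroup G₀] [Module R G₀] [Module.Free R G₀] [Module.Finite R G₀]
    [AddCommGroup G₁] [Module R G₁] [Module.Free R G₁] [Module.Finite R G₁]
    [AddCommGroup Z] [Module R Z] {φ : G₀ →ₗ[R] G₁} {q : G₁ →ₗ[R] Z}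
    (hq : Function.Surjective q) (hφq : Function.Exact φ q)
    (hZ : ∀ j, 1 ≤ j → j ≤ t → Subsingleton (extModule R Z N j))
    (hN : (t : ℕ∞) ≤ moduleDepth R N) :
    (t : ℕ∞) ≤ moduleDepth R ((G₀ →ₗ[R] N) ⧸ LinearMap.range (φ.lcomp R N)) := by
  induction t generalizing G₀ G₁ Z with
  | zero => simp
  | succ t ih =>
    obtain ⟨r, ψ, hψ⟩ := exists_fin_free_cover_exact φ
    have hψ' : Function.Exact ψ φ.rangeRestrict := fun x => by
      rw [← hψ x, Subtype.ext_iff]; rfl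
    have hφs := φ.surjective_rangeRestrict
    have hi : Function.Injective (LinearMap.range φ).subtype := Subtype.val_injective
    have hiq : Function.Exact (LinearMap.range φ).subtype q := fun x => by
      rw [hφq x]; simp
    have hker : LinearMap.ker (ψ.lcomp R N) = LinearMap.range (φ.lcomp R N) := by
      ext h
      constructor
      · intro hh
        obtain ⟨k, hk⟩ := exists_factor_of_exact hφs hψ' (h := h) hh
        obtain ⟨l, hl⟩ := exists_extension_of_subsingleton_extModule_one hi hq hiq
          (hZ 1 le_rfl (by lia)) k
        refine ⟨l, ?_⟩
        rw [← hk, ← hl]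
        rfl
      · rintro ⟨l, rfl⟩
        ext x
        simp [hψ.apply_apply_eq_zero]
    refine le_moduleDepth_left
      (f := (LinearMap.range (φ.lcomp R N)).liftQ (ψ.lcomp R N) hker.ge)
      (g := (LinearMap.range (ψ.lcomp R N)).mkQ) ?_ (Submodule.mkQ_surjective _) ?_ ?_ ?_
    · rw [← LinearMap.ker_eq_bot]
      exact Submodule.ker_liftQ_eq_bot _ _ _ hker.le
    · rw [LinearMap.exact_iff, Submodule.ker_mkQ, Submodule.range_liftQ]
    · exact hN.trans (le_moduleDepth_hom_of_free _ N)
    · refine ih hφs hψ' (fun j hj hjt => ?_) (le_trans (by exact_mod_cast Nat.le_succ t) hN)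
      exact subsingleton_extModule_left hi hq hiq hj (hZ _ (by lia) (by lia))

theorem le_moduleDepth_hom {Y N : Type u} [AddCommGroup Y] [Module R Y] [Module.Finite R Y]
    [AddCommGroup N] [Module R N] {t : ℕ}
    (hY : ∀ j, 1 ≤ j → j ≤ t → Subsingleton (extModule R Y N j))
    (hN : (t : ℕ∞) ≤ moduleDepth R N) : (t : ℕ∞) ≤ moduleDepth R (Y →ₗ[R] N) := by
  obtain ⟨s, q, hq⟩ := Module.Finite.exists_fin' R Y
  obtain ⟨r, ψ, hψ⟩ := exists_fin_free_cover_exact q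
  have hrange : (t : ℕ∞) ≤ moduleDepth R (LinearMap.range (ψ.lcomp R N)) :=
    le_moduleDepth_left_of_le Subtype.val_injective (Submodule.mkQ_surjective _)
      (LinearMap.exact_subtype_mkQ _) (hN.trans (le_moduleDepth_hom_of_free _ N))
      (le_moduleDepth_quotient_range_lcomp t hq hψ hY hN)
  refine le_moduleDepth_left_of_le (f := q.lcomp R N) (g := (ψ.lcomp R N).rangeRestrict) ?_
    (LinearMap.surjective_rangeRestrict _) ?_ (hN.trans (le_moduleDepth_hom_of_free _ N)) hrange
  · intro a b hab
    exact (LinearMap.cancel_right hq).1 hab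
  · intro h
    refine ⟨fun hh => ?_, ?_⟩
    · obtain ⟨k, hk⟩ := exists_factor_of_exact hq hψ (h := h) (congrArg Subtype.val hh)
      exact ⟨k, hk⟩
    · rintro ⟨k, rfl⟩
      refine Subtype.ext ?_
      ext x
      simp [hψ.apply_apply_eq_zero]

theorem moduleDepth_self_le_of_isTotallyReflexive {X : Type u} [AddCommGroup X] [Module R X]
    [Module.Finite R X] (hX : IsTotallyReflexive R X) : moduleDepth R R ≤ moduleDepth R X := by
  rw [moduleDepth_congr (LinearEquiv.ofBijective _ hX.1)]
  exact ENat.forall_natCast_le_iff_le.1 fun t ht =>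
    le_moduleDepth_hom (fun j hj _ => hX.2.2 j hj) ht

/-- Vanishing of `Ext(T, N)` for the transpose `T` of `X` bounds the depth of `X ⊗ N`. -/
theorem le_moduleDepth_tensor_of_transpose {X N F₀ F₁ : Type u} [AddCommGroup X] [Module R X]
    [AddCommGroup N] [Module R N]
    [AddCommGroup F₀] [Module R F₀] [Module.Free R F₀] [Module.Finite R F₀]
    [AddCommGroup F₁] [Module R F₁] [Module.Free R F₁] [Module.Finite R F₁]
    {f : F₁ →ₗ[R] F₀} {g : F₀ →ₗ[R] X} (hg : Function.Surjective g) (hfg : Function.Exact f g)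
    {t : ℕ} (hT : ∀ j, 1 ≤ j → j ≤ t → Subsingleton
      (extModule R (Module.Dual R F₁ ⧸ LinearMap.range (LinearMap.dualMap f)) N j))
    (hN : (t : ℕ∞) ≤ moduleDepth R N) : (t : ℕ∞) ≤ moduleDepth R (X ⊗[R] N) := by
  have key := le_moduleDepth_quotient_range_lcomp t (Submodule.mkQ_surjective _)
    (LinearMap.exact_map_mkQ_range (LinearMap.dualMap f)) hT hN
  let e₀ := (LinearEquiv.rTensor N (Module.evalEquiv R F₀)).trans
    (dualTensorHomEquiv R (Module.Dual R F₀) N)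
  let e₁ := (LinearEquiv.rTensor N (Module.evalEquiv R F₁)).trans
    (dualTensorHomEquiv R (Module.Dual R F₁) N)
  have hnat : e₀.toLinearMap ∘ₗ f.rTensor N =
      (LinearMap.dualMap f).lcomp R N ∘ₗ e₁.toLinearMap := by
    ext x n ψ
    simp [e₀, e₁]
  have hmap : (LinearMap.range (f.rTensor N)).map e₀.toLinearMap =
      LinearMap.range ((LinearMap.dualMap f).lcomp R N) := by
    rw [← LinearMap.range_comp, hnat, LinearMap.range_comp_of_range_eq_top _ e₁.range]
  rwa [← moduleDepth_congr (Submodule.Quotient.equiv _ _ e₀ hmap),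
    moduleDepth_congr ((rTensor_exact N hfg hg).linearEquivOfSurjective
      (LinearMap.rTensor_surjective N hg))] at key

end Transpose

/-- **Corollary 4.4.** Let `R` be a Cohen-Macaulay noetherian local ring and `M`, `N` nonzero
finitely generated `R`-modules.  Suppose `0 → M → P → X → 0` is exact with `P` of finite
projective dimension and `X` totally reflexive, set `n = depth R - depth M > 0` (the
Gorenstein dimension of `M`) and `m = max (depth M) (depth N)`, and let `T` be the transpose
of a finite free presentation of `X`.  If `Tor_i(M, N) = 0` for `1 ≤ i ≤ n`,
`Tor_j(X, N) = 0` for `1 ≤ j ≤ n + 1`, and `Ext^j(T, N) = 0` for `1 ≤ j ≤ m`, then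
`depth(M ⊗ N) + depth R = depth M + depth N`. -/
theorem depth_formula_of_finite_gdim
    (R : Type u) [CommRing R] [IsNoetherianRing R] [IsLocalRing R]
    (hCM : (moduleDepth R R : WithBot ℕ∞) = ringKrullDim R)
    (M N : Type u) [AddCommGroup M] [Module R M] [Module.Finite R M] [Nontrivial M]
    [AddCommGroup N] [Module R N] [Module.Finite R N] [Nontrivial N]
    (P X : Type u) [AddCommGroup P] [Module R P] [Module.Finite R P]
    [AddCommGroup X] [Module R X] [Module.Finite R X]
    (hP : HasFiniteProjectiveDimension R P) (hX : IsTotallyReflexive R X)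
    (ι : M →ₗ[R] P) (π : P →ₗ[R] X)
    (hι : Function.Injective ι) (hπ : Function.Surjective π)
    (hιπ : LinearMap.range ι = LinearMap.ker π)
    (n : ℕ) (hn : moduleDepth R R = moduleDepth R M + (n : ℕ∞)) (hn0 : 0 < n)
    (m : ℕ) (hm : (m : ℕ∞) = max (moduleDepth R M) (moduleDepth R N))
    (F₀ F₁ : Type u)
    [AddCommGroup F₀] [Module R F₀] [Module.Free R F₀] [Module.Finite R F₀]
    [AddCommGroup F₁] [Module R F₁] [Module.Free R F₁] [Module.Finite R F₁]
    (f : F₁ →ₗ[R] F₀) (g : F₀ →ₗ[R] X)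
    (hg : Function.Surjective g) (hfg : LinearMap.range f = LinearMap.ker g)
    (hTorM : ∀ i : ℕ, 1 ≤ i → i ≤ n → Subsingleton (torModule R M N i))
    (hTorX : ∀ j : ℕ, 1 ≤ j → j ≤ n + 1 → Subsingleton (torModule R X N j))
    (hExt : ∀ j : ℕ, 1 ≤ j → j ≤ m →
      Subsingleton (extModule R
        (Module.Dual R F₁ ⧸ LinearMap.range (LinearMap.dualMap f)) N j)) :
    moduleDepth R (TensorProduct R M N) + moduleDepth R R =
      moduleDepth R M + moduleDepth R N := by
  obtain ⟨a, ha⟩ := (ENat.ne_top_iff_exists (n := moduleDepth R M)).1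
    (ne_top_of_le_ne_top (ENat.natCast_ne_top m) (hm ▸ le_max_left _ _))
  obtain ⟨b, hb⟩ := (ENat.ne_top_iff_exists (n := moduleDepth R N)).1
    (ne_top_of_le_ne_top (ENat.natCast_ne_top m) (hm ▸ le_max_right _ _))
  have hιπ' : Function.Exact ι π := LinearMap.exact_iff.2 hιπ.symm
  have hfg' : Function.Exact f g := LinearMap.exact_iff.2 hfg.symm
  have hR : moduleDepth R R = ((a + n : ℕ) : ℕ∞) := by rw [hn, ← ha]; rfl
  have hPM : moduleDepth R M = moduleDepth R P := by
    refine moduleDepth_eq_of_lt hι hπ hιπ' (Or.inl ?_)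
    refine lt_of_lt_of_le ?_ (moduleDepth_self_le_of_isTotallyReflexive hX)
    rw [← ha, hR]
    exact_mod_cast (by lia)
  have : Nontrivial P := hι.nontrivial
  obtain ⟨d, hd⟩ := hP
  obtain ⟨p, -, hp⟩ := exists_moduleDepth_tensor_add_eq d P fun Y _ _ i hi => hd Y i hi
  obtain rfl : p = n := by
    have h := hp R (by rw [hR]; exact ENat.natCast_ne_top _)
      fun i hi _ => subsingleton_torModule_self P hi
    rw [moduleDepth_congr (TensorProduct.rid R P), ← hPM, ← ha, hR] at h
    have : a + p = a + n := by exact_mod_cast h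
    lia
  have hPN := hp N (by rw [← hb]; exact ENat.natCast_ne_top b) fun i hi hip =>
    subsingleton_torModule_middle hι hπ hιπ' hi (hTorM i hi hip) (hTorX i hi (by lia))
  have hXN : (b : ℕ∞) ≤ moduleDepth R (TensorProduct R X N) := by
    refine le_moduleDepth_tensor_of_transpose hg hfg' (fun j hj hjb => hExt j hj ?_) hb.le
    have : (b : ℕ∞) ≤ m := hm ▸ hb ▸ le_max_right _ _
    exact hjb.trans (by exact_mod_cast this)
  obtain ⟨c, hc⟩ := (ENat.ne_top_iff_exists (n := moduleDepth R (TensorProduct R P N))).1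
    (fun h => by rw [h, ← hb] at hPN; exact ENat.natCast_ne_top b hPN.symm)
  rw [← hb, ← hc] at hPN
  have hcb : c + p = b := by exact_mod_cast hPN
  have hMN : moduleDepth R (TensorProduct R M N) = moduleDepth R (TensorProduct R P N) := by
    refine moduleDepth_eq_of_lt
      (rTensor_injective_of_subsingleton_torModule hι hπ hιπ' (hTorX 1 le_rfl (by lia)))
      (LinearMap.rTensor_surjective N hπ) (rTensor_exact N hιπ' hπ)
      (Or.inr (lt_of_lt_of_le ?_ hXN))
    rw [← hc]
    exact_mod_cast (by lia)
  rw [hMN, hR, ← hc, ← ha, ← hb]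
  exact_mod_cast (by lia)
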